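/- (Loneliness Spectrum for n = 3) For any positive integers v₁, v₂, v₃, either there exists a positive integer s with ML(v₁, v₂, v₃) = s/(3s + 1), or ML(v₁, v₂, v₃) ≥ 1/3. -/

import Mathlib

/-- `dnn x` is the distance from `x` to the nearest integer:
`dnn x = min_{m : ℤ} |x - m|`. -/
noncomputable def dnn (x : ℝ) : ℝ := ⨅ m : ℤ, |x - m|

/-- The maximum loneliness of speeds `v 0, …, v (n-1)`:
`ML v = sup_{t : ℝ} min_{i} dnn (t * v i)`. -/
noncomputable def ML {n : ℕ} (v : Fin n → ℝ) : ℝ := ⨆ t : ℝ, ⨅ i, dnn (t * v i)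

noncomputable def f3 (a b c : ℤ) : ℝ :=
  ⨆ t : ℝ, min (dnn (t * a)) (min (dnn (t * b)) (dnn (t * c)))

lemma dnn_bdd (x : ℝ) : BddBelow (Set.range fun m : ℤ => |x - m|) :=
  ⟨0, by rintro _ ⟨m, rfl⟩; exact abs_nonneg _⟩

lemma dnn_le (x : ℝ) (m : ℤ) : dnn x ≤ |x - m| := ciInf_le (dnn_bdd x) m

lemma le_dnn {x μ : ℝ} (l : ℤ) (h1 : l + μ ≤ x) (h2 : x ≤ l + 1 - μ) : μ ≤ dnn x := by
  refine le_ciInf fun m => ?_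
  rcases le_or_gt m l with h | h
  · have : (m : ℝ) ≤ l := by exact_mod_cast h
    exact le_trans (by linarith) (le_abs_self _)
  · have : (l : ℝ) + 1 ≤ m := by exact_mod_cast h
    exact le_trans (by linarith) (neg_le_abs _)

lemma dnn_le_half (x : ℝ) : dnn x ≤ 1 / 2 :=
  (dnn_le x (round x)).trans (by simpa using abs_sub_round x)

lemma dnn_neg (x : ℝ) : dnn (-x) = dnn x := by
  have key : ∀ y : ℝ, dnn y ≤ dnn (-y) := fun y => le_ciInf fun m => by
    have := dnn_le y (-m)
    rwa [← abs_neg, show -(y - ((-m : ℤ) : ℝ)) = -y - m by push_cast; ring] at this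
  exact le_antisymm (by simpa using key (-x)) (key x)

lemma ML_eq (a b c : ℕ) : ML ![(a : ℝ), (b : ℝ), (c : ℝ)] = f3 a b c := by
  unfold ML f3
  congr 1; ext t
  apply le_antisymm
  · have hb : BddBelow (Set.range fun i => dnn (t * ![(a : ℝ), (b : ℝ), (c : ℝ)] i)) :=
      Set.Finite.bddBelow (Set.finite_range _)
    refine le_min ?_ (le_min ?_ ?_)
    · simpa using ciInf_le hb 0
    · simpa using ciInf_le hb 1
    · simpa using ciInf_le hb 2
  · refine le_ciInf fun i => ?_
    fin_cases i <;> simp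

lemma f3_bdd (a b c : ℤ) :
    BddAbove (Set.range fun t : ℝ => min (dnn (t * a)) (min (dnn (t * b)) (dnn (t * c)))) :=
  ⟨1 / 2, by rintro _ ⟨t, rfl⟩; exact (min_le_left _ _).trans (dnn_le_half _)⟩

lemma le_f3 {a b c : ℤ} {μ : ℝ} (t : ℝ) (ha : μ ≤ dnn (t * a)) (hb : μ ≤ dnn (t * b))
    (hc : μ ≤ dnn (t * c)) : μ ≤ f3 a b c :=
  (le_min ha (le_min hb hc)).trans (le_ciSup (f3_bdd a b c) t)

lemma f3_le {a b c : ℤ} {μ : ℝ}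
    (h : ∀ t : ℝ, μ < dnn (t * a) → μ < dnn (t * b) → μ < dnn (t * c) → False) :
    f3 a b c ≤ μ := by
  refine ciSup_le fun t => ?_
  by_contra hh
  push Not at hh
  rw [lt_min_iff, lt_min_iff] at hh
  exact h t hh.1 hh.2.1 hh.2.2

lemma f3_swap12 (a b c : ℤ) : f3 a b c = f3 b a c := by
  unfold f3; congr 1; ext t; exact min_left_comm _ _ _

lemma f3_swap23 (a b c : ℤ) : f3 a b c = f3 a c b := by
  unfold f3; congr 1; ext t; rw [min_comm (dnn (t * b))]

lemma f3_neg (a b c : ℤ) : f3 (-a) b c = f3 a b c := by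
  unfold f3; congr 1; ext t; push_cast; rw [mul_neg, dnn_neg]

lemma f3_smul (g a b c : ℤ) (hg : g ≠ 0) : f3 (g * a) (g * b) (g * c) = f3 a b c := by
  unfold f3
  have hg' : (g : ℝ) ≠ 0 := by exact_mod_cast hg
  refine Function.Surjective.iSup_congr (fun t : ℝ => t * g)
    (fun t => ⟨t / g, by field_simp⟩) fun t => ?_
  push_cast
  simp only [mul_assoc]

def Concl (a b c : ℤ) : Prop :=
  (∃ s : ℕ, 0 < s ∧ f3 a b c = (s : ℝ) / (3 * (s : ℝ) + 1)) ∨ f3 a b c ≥ 1 / 3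

lemma Concl.swap12 {a b c : ℤ} (h : Concl a b c) : Concl b a c := by
  unfold Concl at *; rwa [f3_swap12 b a c]
lemma Concl.swap23 {a b c : ℤ} (h : Concl a b c) : Concl a c b := by
  unfold Concl at *; rwa [f3_swap23 a c b]
lemma Concl.neg1 {a b c : ℤ} (h : Concl (-a) b c) : Concl a b c := by
  unfold Concl at *; rwa [f3_neg] at h

/-- Multiples of a non-integer meet the middle third. -/
lemma exists_mul_mid (x : ℝ) (hx : ∀ l : ℤ, x ≠ l) :
    ∃ n l : ℤ, l + 1 / 3 ≤ n * x ∧ n * x ≤ (l : ℝ) + 1 - 1 / 3 := by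
  have key : ∀ y : ℝ, 0 < y → y ≤ 1 / 3 → ∃ n : ℤ, 1 / 3 ≤ n * y ∧ n * y ≤ 1 - 1 / 3 := by
    intro y h0 h1
    refine ⟨⌈1 / (3 * y)⌉, ?_, ?_⟩
    · have := Int.le_ceil (1 / (3 * y))
      have := mul_le_mul_of_nonneg_right this h0.le
      have e : 1 / (3 * y) * y = 1 / 3 := by field_simp
      linarith
    · have := (Int.ceil_lt_add_one (1 / (3 * y))).le
      have := mul_le_mul_of_nonneg_right this h0.le
      have e : (1 / (3 * y) + 1) * y = 1 / 3 + y := by field_simp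
      linarith
  have h0 : 0 < Int.fract x := lt_of_le_of_ne (Int.fract_nonneg x) (fun h => by
    apply hx ⌊x⌋
    have := Int.floor_add_fract x
    linarith)
  have h1 := Int.fract_lt_one x
  have h2 := Int.floor_add_fract x
  rcases le_or_gt (Int.fract x) (1 / 3) with h | h
  · obtain ⟨n, hn⟩ := key _ h0 h
    refine ⟨n, n * ⌊x⌋, ?_⟩
    have : (n : ℝ) * x = n * ⌊x⌋ + n * Int.fract x := by rw [← mul_add, h2]
    push_cast
    constructor <;> linarith
  rcases le_or_gt (Int.fract x) (2 / 3) with h' | h'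
  · refine ⟨1, ⌊x⌋, ?_⟩
    push_cast
    constructor <;> linarith
  · obtain ⟨n, hn⟩ := key (1 - Int.fract x) (by linarith) (by linarith)
    refine ⟨-n, -n * (⌊x⌋ + 1), ?_⟩
    have : ((-n : ℤ) : ℝ) * x = -n * (⌊x⌋ + 1) + n * (1 - Int.fract x) := by
      push_cast; linear_combination n * h2
    rw [this]
    push_cast
    constructor <;> linarith

/-- The same, for a fraction `c / q`. -/
lemma exists_frac_mid (c q : ℤ) (hq : q ≠ 0) (h : ¬ q ∣ c) :
    ∃ n l : ℤ, (l : ℝ) + 1 / 3 ≤ n / q * c ∧ n / q * c ≤ (l : ℝ) + 1 - 1 / 3 := by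
  have hq' : (q : ℝ) ≠ 0 := by exact_mod_cast hq
  obtain ⟨n, l, h1, h2⟩ := exists_mul_mid ((c : ℝ) / q) (fun l hl => h ⟨l, by
    rw [div_eq_iff hq'] at hl
    have : c = l * q := by exact_mod_cast hl
    rw [this, mul_comm]⟩)
  have e : (n : ℝ) / q * c = n * (c / q) := by ring
  exact ⟨n, l, by rw [e]; exact h1, by rw [e]; exact h2⟩

/-- Success criterion. -/
lemma success {a b c : ℤ} (hab : (3 : ℤ) ∣ a - b) (ha : ¬ (3 : ℤ) ∣ a) (hc : (3 : ℤ) ∣ c)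
    (t : ℝ) (i l m : ℤ) (h1 : (i : ℝ) ≤ 3 * (a * t)) (h2 : 3 * (a * t) ≤ i + 1)
    (h3 : (i + 3 * l : ℝ) ≤ 3 * (b * t)) (h4 : 3 * (b * t) ≤ i + 3 * l + 1)
    (h5 : (m : ℝ) + 1 / 3 ≤ t * c) (h6 : t * c ≤ (m : ℝ) + 1 - 1 / 3) :
    f3 a b c ≥ 1 / 3 := by
  obtain ⟨k, u, hk⟩ : ∃ k u : ℤ, a * k + i = 1 + 3 * u := by
    rcases (by omega : a % 3 = 1 ∨ a % 3 = 2) with h | h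
    · refine ⟨1 - i, a / 3 * (1 - i), ?_⟩
      have := Int.emod_add_mul_ediv a 3
      rw [h] at this
      linear_combination (i - 1) * this
    · refine ⟨i - 1, a / 3 * (i - 1) + i - 1, ?_⟩
      have := Int.emod_add_mul_ediv a 3
      rw [h] at this
      linear_combination (1 - i) * this
  obtain ⟨d, hd⟩ := hab
  obtain ⟨w, hw⟩ := hc
  have hk' : (a : ℝ) * k + i = 1 + 3 * u := by exact_mod_cast hk
  have hd' : (a : ℝ) - b = 3 * d := by exact_mod_cast hd
  have hw' : (c : ℝ) = 3 * w := by exact_mod_cast hw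
  refine le_f3 (t + k / 3) (le_dnn u ?_ ?_) (le_dnn (u - d * k + l) ?_ ?_)
    (le_dnn (m + w * k) ?_ ?_)
  · linarith
  · linarith
  · have : (t + k / 3) * b = (3 * (b * t) + a * k - 3 * d * k) / 3 := by
      linear_combination (-k / 3 : ℝ) * hd'
    rw [this]; push_cast; linarith
  · have : (t + k / 3) * b = (3 * (b * t) + a * k - 3 * d * k) / 3 := by
      linear_combination (-k / 3 : ℝ) * hd'
    rw [this]; push_cast; linarith
  · have : (t + k / 3) * c = t * c + w * k := by
      linear_combination (k / 3 : ℝ) * hw'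
    rw [this]; push_cast; linarith
  · have : (t + k / 3) * c = t * c + w * k := by
      linear_combination (k / 3 : ℝ) * hw'
    rw [this]; push_cast; linarith

/-- Upper bound for a zero-sum triple: one orientation. -/
lemma zero_sum_aux {a b c Q s : ℤ} (h0 : a + b + c = 0) (hQ : a - b = Q) (hs : Q = 3 * s + 1)
    (hQ0 : 0 < Q) (h1 : b - c ≤ Q) (h2 : c - a ≤ Q) (t : ℝ) (k l m : ℤ)
    (hk : (s : ℝ) < Q * (a * t - k)) (hl : (s : ℝ) < Q * (b * t - l))
    (hm : (s : ℝ) < Q * (c * t - m)) (hsum : k + l + m = -1) : False := by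
  obtain ⟨E, hE⟩ : ∃ E : ℤ, E = 3 * (a * l - b * k) + Q := ⟨_, rfl⟩
  have h0' : (a : ℝ) + b + c = 0 := by exact_mod_cast h0
  have hQ' : (a : ℝ) - b = Q := by exact_mod_cast hQ
  have hs' : (Q : ℝ) = 3 * s + 1 := by exact_mod_cast hs
  have hQ0' : (0 : ℝ) < Q := by exact_mod_cast hQ0
  have h1' : (b : ℝ) - c ≤ Q := by exact_mod_cast h1
  have h2' : (c : ℝ) - a ≤ Q := by exact_mod_cast h2
  have hsum' : (k : ℝ) + l + m = -1 := by exact_mod_cast hsum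
  have hE' : (E : ℝ) = 3 * (a * l - b * k) + Q := by exact_mod_cast hE
  obtain ⟨X, hX⟩ : ∃ X : ℝ, X = Q * (a * t - k) - s := ⟨_, rfl⟩
  obtain ⟨Y, hY⟩ : ∃ X : ℝ, X = Q * (b * t - l) - s := ⟨_, rfl⟩
  obtain ⟨Z, hZ⟩ : ∃ X : ℝ, X = Q * (c * t - m) - s := ⟨_, rfl⟩
  have X0 : 0 < X := by linarith
  have Y0 : 0 < Y := by linarith
  have Z0 : 0 < Z := by linarith
  have S : X + Y + Z = 1 := by
    rw [hX, hY, hZ]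
    linear_combination (Q * t) * h0' - Q * hsum' + hs'
  have key : (Q : ℝ) * E = X * (b - c) + Y * (c - a) + Z * (a - b) := by
    have hc : (c : ℝ) = -a - b := by linarith
    have hm' : (m : ℝ) = -1 - k - l := by linarith
    rw [hX, hY, hZ, hE', hc, hm', ← hQ']
    ring
  have up : E < 1 := by
    have : (Q : ℝ) * E < Q * 1 := by
      have e : (Q : ℝ) * 1 - Q * E = X * (Q - (b - c)) + Y * (Q - (c - a)) := by
        rw [key, hQ']; linear_combination (-Q : ℝ) * S
      have p1 := mul_nonneg X0.le (sub_nonneg.2 h1')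
      have p2 := mul_nonneg Y0.le (sub_nonneg.2 h2')
      rcases lt_or_eq_of_le h1' with h | h
      · have := mul_pos X0 (sub_pos.2 h)
        linarith
      · have := mul_pos Y0 (show (0 : ℝ) < Q - (c - a) by linarith)
        linarith
    exact_mod_cast lt_of_mul_lt_mul_left this hQ0'.le
  have lo : -2 < E := by
    have : (Q : ℝ) * (-2) < Q * E := by
      have e : (Q : ℝ) * E - Q * (-2) =
          X * (b - c + 2 * Q) + Y * (c - a + 2 * Q) + Z * (3 * Q) := by
        rw [key, hQ']; linear_combination (-2 * Q : ℝ) * S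
      have p1 := mul_nonneg X0.le (show (0 : ℝ) ≤ b - c + 2 * Q by linarith)
      have p2 := mul_nonneg Y0.le (show (0 : ℝ) ≤ c - a + 2 * Q by linarith)
      have p3 := mul_pos Z0 (show (0 : ℝ) < 3 * Q by linarith)
      linarith
    exact_mod_cast lt_of_mul_lt_mul_left this hQ0'.le
  omega

/-- From a large distance to the nearest integer, extract the fractional part bounds. -/
lemma dnn_gt {x μ : ℝ} (h : μ < dnn x) : ∃ k : ℤ, μ < x - k ∧ x - k < 1 - μ := by
  refine ⟨⌊x⌋, ?_, ?_⟩
  · have := dnn_le x ⌊x⌋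
    rw [abs_of_nonneg (by linarith [Int.floor_le x])] at this
    linarith
  · have := dnn_le x (⌊x⌋ + 1)
    push_cast at this
    rw [abs_of_nonpos (by linarith [Int.lt_floor_add_one x])] at this
    linarith

lemma zero_sum_max {a b c Q : ℤ} (ha : a ≠ 0) (hb : b ≠ 0) (hc : c ≠ 0)
    (h0 : a + b + c = 0) (hQ : a - b = Q) (hQ3 : Q % 3 = 1)
    (h1 : b - c ≤ Q) (h2 : c - a ≤ Q) (hco : IsCoprime a b) :
    ∃ s : ℕ, 0 < s ∧ f3 a b c = (s : ℝ) / (3 * (s : ℝ) + 1) := by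
  obtain ⟨s, hs⟩ : ∃ s : ℤ, Q = 3 * s + 1 := ⟨Q / 3, by omega⟩
  have hQ0 : 0 < Q := by omega
  have hs0 : 0 < s := by omega
  have hQ0' : (0 : ℝ) < Q := by exact_mod_cast hQ0
  have hs' : (Q : ℝ) = 3 * s + 1 := by exact_mod_cast hs
  have hs0' : (1 : ℝ) ≤ s := by exact_mod_cast hs0
  have hQ' : (a : ℝ) - b = Q := by exact_mod_cast hQ
  have h0' : (a : ℝ) + b + c = 0 := by exact_mod_cast h0
  suffices h : f3 a b c = (s : ℝ) / Q by
    refine ⟨s.toNat, by omega, ?_⟩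
    have : ((s.toNat : ℕ) : ℝ) = (s : ℝ) := by
      exact_mod_cast Int.toNat_of_nonneg hs0.le
    rw [this, h, hs']
  apply le_antisymm
  · apply f3_le
    intro t hta htb htc
    obtain ⟨k, k1, k2⟩ := dnn_gt hta
    obtain ⟨l, l1, l2⟩ := dnn_gt htb
    obtain ⟨m, m1, m2⟩ := dnn_gt htc
    have hq : (s : ℝ) / Q * Q = s := by field_simp
    have conv1 : ∀ x : ℝ, (s : ℝ) / Q < x → (s : ℝ) < Q * x := fun x hx => by
      have := mul_lt_mul_of_pos_right hx hQ0'
      linarith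
    have hpos : (0 : ℝ) ≤ s / Q := by positivity
    have esum : t * a + t * b + t * c = 0 := by linear_combination t * h0'
    have u1 : k + l + m < 0 := by
      have : ((k + l + m : ℤ) : ℝ) < 0 := by push_cast; linarith
      exact_mod_cast this
    have u2 : -3 < k + l + m := by
      have : ((-3 : ℤ) : ℝ) < ((k + l + m : ℤ) : ℝ) := by push_cast; linarith
      exact_mod_cast this
    rcases (by omega : k + l + m = -1 ∨ k + l + m = -2) with h | h
    · refine zero_sum_aux h0 hQ hs hQ0 h1 h2 t k l m (conv1 _ ?_) (conv1 _ ?_) (conv1 _ ?_) h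
      all_goals linarith
    · refine zero_sum_aux h0 hQ hs hQ0 h1 h2 (-t) (-k - 1) (-l - 1) (-m - 1)
        (conv1 _ ?_) (conv1 _ ?_) (conv1 _ ?_) (by omega)
      all_goals push_cast; linarith
  · have hco' : IsCoprime a Q := by
      rw [← hQ, show a - b = -b + a * 1 by ring]
      exact (IsCoprime.neg_right hco).add_mul_left_right 1
    obtain ⟨u, v, huv⟩ := hco'
    have e : (u : ℝ) * a + v * Q = 1 := by exact_mod_cast huv
    have ea : ((s * u : ℤ) : ℝ) / Q * a = s / Q - s * v := by
      push_cast; field_simp; linear_combination e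
    have eb : ((s * u : ℤ) : ℝ) / Q * b = s / Q - s * v - s * u := by
      have : (b : ℝ) = a - Q := by linarith
      rw [this, mul_sub, ea]; push_cast; field_simp
    have ec : ((s * u : ℤ) : ℝ) / Q * c = -(2 * s / Q) + 2 * s * v + s * u := by
      have : (c : ℝ) = -a - b := by linarith
      rw [this, mul_sub, eb, mul_neg, ea]; ring
    have q1 : (s : ℝ) / Q ≤ 1 - s / Q := by
      have : (s : ℝ) / Q + s / Q ≤ 1 := by
        rw [← add_div, div_le_one hQ0']; linarith
      linarith
    have q2 : (s : ℝ) / Q + 2 * s / Q ≤ 1 := by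
      rw [← add_div, div_le_one hQ0']; linarith
    have q3 : (s : ℝ) / Q ≤ 2 * s / Q := by
      gcongr; linarith
    refine le_f3 (((s * u : ℤ) : ℝ) / Q) (le_dnn (-(s * v)) ?_ ?_)
      (le_dnn (-(s * v) - s * u) ?_ ?_) (le_dnn (2 * s * v + s * u - 1) ?_ ?_)
    all_goals first | rw [ea] | rw [eb] | rw [ec]
    all_goals push_cast; linarith

lemma zero_sum {a b c : ℤ} (ha : a ≠ 0) (hb : b ≠ 0) (hc : c ≠ 0)
    (h0 : a + b + c = 0) (h3 : (a - b) % 3 = 1) (hco : IsCoprime a b) : Concl a b c := by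
  left
  have hbc : IsCoprime b c := by
    rw [show c = -a + b * (-1) by linarith]
    exact (IsCoprime.neg_right hco.symm).add_mul_left_right _
  have hca : IsCoprime c a := by
    rw [show c = -b + a * (-1) by linarith]
    exact ((IsCoprime.neg_right hco).add_mul_left_right _).symm
  by_cases h1 : b - c ≤ a - b ∧ c - a ≤ a - b
  · exact zero_sum_max ha hb hc h0 rfl h3 h1.1 h1.2 hco
  by_cases h2 : a - b ≤ b - c ∧ c - a ≤ b - c
  · rw [f3_swap12, f3_swap23]
    exact zero_sum_max hb hc ha (by omega) rfl (by omega) h2.2 h2.1 hbc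
  · rw [f3_swap23, f3_swap12]
    exact zero_sum_max hc ha hb (by omega) rfl (by omega) (by omega) (by omega) hca

lemma one_two (s : ℤ) (hs0 : 0 < s) : Concl 1 2 (3 * s) := by
  left
  have hs0' : (1 : ℝ) ≤ s := by exact_mod_cast hs0
  obtain ⟨σ, hσ⟩ : ∃ σ : ℝ, σ = s / (3 * s + 1) := ⟨_, rfl⟩
  have hσ' : 3 * s * σ = s - σ := by
    have : (3 * (s : ℝ) + 1) ≠ 0 := by positivity
    rw [hσ]; field_simp; ring
  have hσ0 : 0 < σ := by rw [hσ]; positivity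
  have hσ1 : 4 * σ ≥ 1 := by nlinarith
  have hσ3 : 3 * σ < 1 := by nlinarith
  suffices h : f3 1 2 (3 * s) = σ by
    refine ⟨s.toNat, by omega, ?_⟩
    have : ((s.toNat : ℕ) : ℝ) = (s : ℝ) := by
      exact_mod_cast Int.toNat_of_nonneg hs0.le
    rw [this, h, hσ]
  have aux : ∀ (x : ℝ) (k : ℤ), σ < dnn (x * 2) → σ < dnn (x * (3 * s)) → σ < x - k →
      x - k ≤ 1 / 2 → False := by
    intro x k h2 h3 h1 h4
    have h2' := h2.trans_le (dnn_le _ (2 * k + 1))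
    have h3' := h3.trans_le (dnn_le _ (3 * s * k + s))
    push_cast at h2' h3'
    rw [abs_of_nonpos (by linarith)] at h2'
    have e : x * (3 * s) - (3 * s * k + s) = 3 * s * (x - k - 1 / 3) := by ring
    rw [e, lt_abs] at h3'
    have b1 : 3 * s * (x - k - 1 / 3) ≤ 3 * s * ((1 - σ) / 2 - 1 / 3) := by
      gcongr; linarith
    have b2 : 3 * s * (σ - 1 / 3) ≤ 3 * s * (x - k - 1 / 3) := by
      gcongr
    rcases h3' with h | h <;> nlinarith
  apply le_antisymm
  · apply f3_le
    intro t h1 h2 h3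
    push_cast at h1 h2 h3
    rw [mul_one] at h1
    obtain ⟨k, k1, k2⟩ := dnn_gt h1
    rcases le_or_gt (t - k) (1 / 2) with h | h
    · exact aux t k h2 h3 k1 h
    · refine aux (-t) (-k - 1) ?_ ?_ ?_ ?_
      · rwa [neg_mul, dnn_neg]
      · rwa [neg_mul, dnn_neg]
      · push_cast; linarith
      · push_cast; linarith
  · refine le_f3 σ (le_dnn 0 ?_ ?_) (le_dnn 0 ?_ ?_) (le_dnn (s - 1) ?_ ?_)
    all_goals push_cast; linarith

lemma same_sign {a b c : ℤ} (hb : 0 < b) (hba : b ≤ a) (hc : 0 < c) (hab : (3 : ℤ) ∣ a - b)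
    (ha3 : ¬ (3 : ℤ) ∣ a) (hc3 : (3 : ℤ) ∣ c) (hne : c ≠ a - b) : f3 a b c ≥ 1 / 3 := by
  have hb' : (0 : ℝ) < b := by exact_mod_cast hb
  have hba' : (b : ℝ) ≤ a := by exact_mod_cast hba
  have hc' : (0 : ℝ) < c := by exact_mod_cast hc
  have ec : 1 / (3 * (c : ℝ)) * c = 1 / 3 := by field_simp
  have ea : ∀ x : ℝ, 3 * (x * (1 / (3 * c))) = x / c := fun x => by field_simp
  rcases le_or_gt a c with hac | hac
  · -- `t = 1 / (3 c)`
    have hac' : (a : ℝ) ≤ c := by exact_mod_cast hac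
    refine success hab ha3 hc3 (1 / (3 * c)) 0 0 0 ?_ ?_ ?_ ?_ ?_ ?_
    · push_cast; rw [ea]; exact div_nonneg (by linarith) hc'.le
    · push_cast; rw [ea, zero_add, div_le_one hc']; exact hac'
    · push_cast; simp; positivity
    · push_cast; rw [ea]; simp only [mul_zero, add_zero, zero_add]
      rw [div_le_one hc']; linarith
    · rw [ec]; norm_num
    · rw [ec]; norm_num
  by_cases hd : (a - b) ∣ c
  · obtain ⟨m, hm⟩ := hd
    have hd0 : 0 < a - b := by
      rcases eq_or_lt_of_le hba with h | h
      · rw [h] at hm; simp at hm; omega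
      · omega
    have hm2 : 2 ≤ m := by
      by_contra hlt
      have : m ≤ 1 := by omega
      rcases eq_or_lt_of_le this with h | h
      · rw [h, mul_one] at hm; exact hne hm
      · nlinarith
    have h2c : 2 * (a - b) ≤ c := by nlinarith
    have h2c' : 2 * ((a : ℝ) - b) ≤ c := by exact_mod_cast h2c
    have hac' : (c : ℝ) < a := by exact_mod_cast hac
    -- `p = ⌊b / c⌋ + 1` is the next boundary for `b`
    obtain ⟨p, hp⟩ : ∃ p : ℤ, p = ⌊(b : ℝ) / c⌋ + 1 := ⟨_, rfl⟩
    have p1 : (b : ℝ) < p * c := by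
      rw [hp, ← div_lt_iff₀ hc']; push_cast; exact Int.lt_floor_add_one _
    have p2 : ((p : ℝ) - 1) * c ≤ b := by
      rw [hp, ← le_div_iff₀ hc']; push_cast
      have := Int.floor_le ((b : ℝ) / c); linarith
    rcases le_or_gt ((a : ℝ)) (p * c) with h | h
    · refine success hab ha3 hc3 (1 / (3 * c)) (p - 1) 0 0 ?_ ?_ ?_ ?_ ?_ ?_
      · rw [ea, le_div_iff₀ hc']; push_cast; linarith
      · rw [ea, div_le_iff₀ hc']; push_cast; linarith
      · rw [ea, le_div_iff₀ hc']; push_cast; linarith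
      · rw [ea, div_le_iff₀ hc']; push_cast; linarith
      · rw [ec]; norm_num
      · rw [ec]; norm_num
    · have hpb : (p : ℝ) * c ≤ 2 * b := by linarith
      have eb : 3 * ((b : ℝ) * (p / (3 * b))) = p := by field_simp
      have ea' : 3 * ((a : ℝ) * (p / (3 * b))) = p + p * (a - b) / b := by field_simp; ring
      have hp0 : (0 : ℝ) < p := by
        have : 0 < (p : ℝ) * c := by linarith
        exact (pos_iff_pos_of_mul_pos this).2 hc'
      have hlt : (p : ℝ) * (a - b) / b ≤ 1 := by
        rw [div_le_one hb']
        have := mul_le_mul_of_nonneg_left h2c' hp0.le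
        linarith
      have hnn : (0 : ℝ) ≤ p * (a - b) / b :=
        div_nonneg (mul_nonneg hp0.le (by linarith)) hb'.le
      refine success hab ha3 hc3 (p / (3 * b)) p 0 0 ?_ ?_ ?_ ?_ ?_ ?_
      · rw [ea']; linarith
      · rw [ea']; linarith
      · rw [eb]; push_cast; linarith
      · rw [eb]; push_cast; linarith
      · rw [div_mul_eq_mul_div, le_div_iff₀ (by positivity)]; push_cast; linarith
      · rw [div_mul_eq_mul_div, div_le_iff₀ (by positivity)]; push_cast; linarith
  · -- `t = n / (a - b)`, or any middle time when `a = b`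
    rcases eq_or_lt_of_le hba with h | h
    · subst h
      have e2 : 1 / (2 * (c : ℝ)) * c = 1 / 2 := by field_simp
      refine success hab ha3 hc3 (1 / (2 * c)) ⌊3 * ((b : ℝ) * (1 / (2 * c)))⌋ 0 0
        (Int.floor_le _) (Int.lt_floor_add_one _).le ?_ ?_ ?_ ?_
      · push_cast; rw [mul_zero, add_zero]; exact Int.floor_le _
      · push_cast; rw [mul_zero, add_zero]; exact (Int.lt_floor_add_one _).le
      · rw [e2]; norm_num
      · rw [e2]; norm_num
    · obtain ⟨n, l, h1, h2⟩ := exists_frac_mid c (a - b) (by omega) hd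
      have hq : ((a - b : ℤ) : ℝ) ≠ 0 := by
        have : a - b ≠ 0 := by omega
        exact_mod_cast this
      obtain ⟨t, ht⟩ : ∃ t : ℝ, t = n / ((a - b : ℤ) : ℝ) := ⟨_, rfl⟩
      have hn : (a : ℝ) * t - b * t = n := by
        rw [ht, ← sub_mul]; push_cast at hq ⊢; field_simp
      rw [← ht] at h1 h2
      have f1 := Int.floor_le (3 * ((a : ℝ) * t))
      have f2 := (Int.lt_floor_add_one (3 * ((a : ℝ) * t))).le
      refine success hab ha3 hc3 t ⌊3 * ((a : ℝ) * t)⌋ (-n) l f1 f2 ?_ ?_ h1 h2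
      · push_cast; linarith
      · push_cast; linarith

lemma opp_sign {a b c : ℤ} (ha : 0 < a) (hb : 0 < b) (hc : 0 < c) (hab : (3 : ℤ) ∣ a + b)
    (ha3 : ¬ (3 : ℤ) ∣ a) (hc3 : (3 : ℤ) ∣ c) (hne : c ≠ a + b) (h3 : a + b ≠ 3)
    (hco : a + b ∣ c → IsCoprime a b) : f3 a b c ≥ 1 / 3 := by
  have hb' : (0 : ℝ) < b := by exact_mod_cast hb
  have ha' : (0 : ℝ) < a := by exact_mod_cast ha
  have hc' : (0 : ℝ) < c := by exact_mod_cast hc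
  rw [f3_swap12, ← f3_neg, f3_swap12]
  have hab' : (3 : ℤ) ∣ a - -b := by simpa using hab
  by_cases hd : (a + b) ∣ c
  · have hcop := hco hd
    obtain ⟨m, hm⟩ := hd
    obtain ⟨N, hN⟩ := hab
    have hN2 : 2 ≤ N := by omega
    have hm2 : 2 ≤ m := by
      by_contra hlt
      have : m ≤ 1 := by omega
      rcases eq_or_lt_of_le this with h | h
      · rw [h, mul_one] at hm; exact hne hm
      · nlinarith
    -- `j = ⌈b / (3 m)⌉`
    obtain ⟨j, j1, j2⟩ : ∃ j : ℤ, b ≤ 3 * m * j ∧ 3 * m * j ≤ 3 * m * N - a := by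
      refine ⟨(b + 3 * m - 1) / (3 * m), ?_, ?_⟩
      · have h1 := Int.emod_add_mul_ediv (b + 3 * m - 1) (3 * m)
        have h2 := Int.emod_lt_of_pos (b + 3 * m - 1) (show 0 < 3 * m by omega)
        linarith
      · have h1 := Int.emod_add_mul_ediv (b + 3 * m - 1) (3 * m)
        have h2 := Int.emod_nonneg (b + 3 * m - 1) (show 3 * m ≠ 0 by omega)
        nlinarith
    -- `n` with `a n = N k + j`
    have hcoN : IsCoprime a N := by
      have : IsCoprime a (3 * N) := by
        rw [← hN, show a + b = b + a * 1 by ring]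
        exact hcop.add_mul_left_right 1
      exact this.of_mul_right_right
    obtain ⟨u, v, huv⟩ := hcoN
    obtain ⟨n, k, hn⟩ : ∃ n k : ℤ, a * n = N * k + j :=
      ⟨u * j, -v * j, by linear_combination j * huv⟩
    have hNp : (0 : ℝ) < N := by exact_mod_cast (by omega : 0 < N)
    have hmp : (0 : ℝ) < m := by exact_mod_cast (by omega : 0 < m)
    have hcr : (c : ℝ) = 3 * N * m := by
      have : c = 3 * N * m := by rw [hm, hN]
      exact_mod_cast this
    have hnr : (a : ℝ) * n = N * k + j := by exact_mod_cast hn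
    have hNr : (a : ℝ) + b = 3 * N := by exact_mod_cast hN
    have j1r : (b : ℝ) ≤ 3 * m * j := by exact_mod_cast j1
    have j2r : (3 : ℝ) * m * j ≤ 3 * m * N - a := by exact_mod_cast j2
    have hj0 : (0 : ℝ) ≤ 3 * m * j := by linarith
    obtain ⟨t, ht⟩ : ∃ t : ℝ, t = n / (3 * N) + 1 / (3 * c) := ⟨_, rfl⟩
    have ea : 3 * ((a : ℝ) * t) = k + (3 * m * j + a) / (3 * m * N) := by
      rw [ht, hcr]; field_simp; linear_combination 3 * m * hnr
    have eb : 3 * (((-b : ℤ) : ℝ) * t) = k - 3 * n + (3 * m * j - b) / (3 * m * N) := by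
      have hbb : (b : ℝ) = 3 * N - a := by linarith
      rw [ht, hcr]; push_cast; rw [hbb]; field_simp; linear_combination 3 * m * hnr
    have et : t * c = n * m + 1 / 3 := by
      rw [ht, hcr]; field_simp
    have hD : (0 : ℝ) < 3 * m * N := by positivity
    have g1 : (0 : ℝ) ≤ (3 * m * j + a) / (3 * m * N) := div_nonneg (by linarith) hD.le
    have g2 : ((3 : ℝ) * m * j + a) / (3 * m * N) ≤ 1 := by rw [div_le_one hD]; linarith
    have g3 : (0 : ℝ) ≤ (3 * m * j - b) / (3 * m * N) := div_nonneg (by linarith) hD.le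
    have g4 : ((3 : ℝ) * m * j - b) / (3 * m * N) ≤ 1 := by rw [div_le_one hD]; linarith
    refine success hab' ha3 hc3 t k (-n) (n * m) ?_ ?_ ?_ ?_ ?_ ?_
    · rw [ea]; linarith
    · rw [ea]; linarith
    · rw [eb]; push_cast; linarith
    · rw [eb]; push_cast; linarith
    · rw [et]; push_cast; linarith
    · rw [et]; push_cast; linarith
  · obtain ⟨n, l, h1, h2⟩ := exists_frac_mid c (a + b) (by omega) hd
    have hq : ((a + b : ℤ) : ℝ) ≠ 0 := by
      have : a + b ≠ 0 := by omega
      exact_mod_cast this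
    obtain ⟨t, ht⟩ : ∃ t : ℝ, t = n / ((a + b : ℤ) : ℝ) := ⟨_, rfl⟩
    have hn : (a : ℝ) * t + b * t = n := by
      rw [ht, ← add_mul]; push_cast at hq ⊢; field_simp
    rw [← ht] at h1 h2
    have f1 := Int.floor_le (3 * ((a : ℝ) * t))
    have f2 := (Int.lt_floor_add_one (3 * ((a : ℝ) * t))).le
    refine success hab' ha3 hc3 t ⌊3 * ((a : ℝ) * t)⌋ (-n) l f1 f2 ?_ ?_ h1 h2
    · push_cast; linarith
    · push_cast; linarith

/-- Exactly one speed divisible by 3. -/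
lemma single_div {a b c : ℤ} (hb : 0 < b) (hba : b ≤ a) (hc : 0 < c)
    (ha3 : ¬ (3 : ℤ) ∣ a) (hb3 : ¬ (3 : ℤ) ∣ b) (hc3 : (3 : ℤ) ∣ c)
    (hg : ∀ d : ℤ, d ∣ a → d ∣ b → d ∣ c → IsUnit d) : Concl a b c := by
  have hcop : (∀ d : ℤ, d ∣ a → d ∣ b → d ∣ c) → IsCoprime a b := fun h => by
    rw [Int.isCoprime_iff_gcd_eq_one]
    have := hg (Int.gcd a b) (Int.gcd_dvd_left _ _) (Int.gcd_dvd_right _ _)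
      (h _ (Int.gcd_dvd_left _ _) (Int.gcd_dvd_right _ _))
    rw [Int.isUnit_iff] at this
    omega
  by_cases hab : (3 : ℤ) ∣ a - b
  · by_cases hne : c = a - b
    · have hco := hcop fun d h1 h2 => hne ▸ dvd_sub h1 h2
      -- triple `(a, -b, -c)`
      rcases (by omega : (a + b) % 3 = 1 ∨ (a + b) % 3 = 2) with h | h
      · have := zero_sum (a := a) (b := -b) (c := -c) (by omega) (by omega) (by omega)
          (by omega) (by omega) hco.neg_right
        exact this.swap12.neg1.swap12.swap23.swap12.neg1.swap12.swap23
      · have := zero_sum (a := -b) (b := a) (c := -c) (by omega) (by omega) (by omega)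
          (by omega) (by omega) hco.neg_right.symm
        exact this.neg1.swap23.swap12.neg1.swap12.swap23.swap12
    · exact Or.inr (same_sign hb hba hc hab ha3 hc3 hne)
  · have hab' : (3 : ℤ) ∣ a + b := by
      rcases (by omega : a % 3 = 1 ∨ a % 3 = 2) with h | h <;>
        rcases (by omega : b % 3 = 1 ∨ b % 3 = 2) with h' | h' <;> omega
    by_cases hne : c = a + b
    · have hco := hcop fun d h1 h2 => hne ▸ dvd_add h1 h2
      rcases (by omega : (a - b) % 3 = 1 ∨ (b - a) % 3 = 1) with h | h
      · have := zero_sum (a := a) (b := b) (c := -c) (by omega) (by omega) (by omega)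
          (by omega) (by omega) hco
        exact this.swap23.swap12.neg1.swap12.swap23
      · have := zero_sum (a := b) (b := a) (c := -c) (by omega) (by omega) (by omega)
          (by omega) (by omega) hco.symm
        exact this.swap23.swap12.neg1.swap12.swap23.swap12
    by_cases h3 : a + b = 3
    · obtain ⟨s, rfl⟩ := hc3
      obtain rfl : b = 1 := by omega
      obtain rfl : a = 2 := by omega
      exact (one_two s (by omega)).swap12
    · exact Or.inr (opp_sign (by omega) hb hc hab' ha3 hc3 hne h3 fun hd =>
        hcop fun d h1 h2 => (dvd_add h1 h2).trans hd)

lemma single_div' {a b c : ℤ} (ha : 0 < a) (hb : 0 < b) (hc : 0 < c)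
    (ha3 : ¬ (3 : ℤ) ∣ a) (hb3 : ¬ (3 : ℤ) ∣ b) (hc3 : (3 : ℤ) ∣ c)
    (hg : ∀ d : ℤ, d ∣ a → d ∣ b → d ∣ c → IsUnit d) : Concl a b c := by
  rcases le_total b a with h | h
  · exact single_div hb h hc ha3 hb3 hc3 hg
  · exact (single_div ha h hc hb3 ha3 hc3 fun d h1 h2 h3 => hg d h2 h1 h3).swap12

/-- Two speeds divisible by 3, the third one not. -/
lemma two_div {a b c : ℤ} (ha : 0 < a) (hb : 0 < b)
    (ha3 : (3 : ℤ) ∣ a) (hb3 : (3 : ℤ) ∣ b) (hc3 : ¬ (3 : ℤ) ∣ c) : Concl a b c := by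
  right
  have hnd : ¬ (a + b) ∣ a := fun h => by have := Int.le_of_dvd ha h; omega
  obtain ⟨n, l, h1, h2⟩ := exists_frac_mid a (a + b) (by omega) hnd
  have hq : ((a + b : ℤ) : ℝ) ≠ 0 := by
    have : a + b ≠ 0 := by omega
    exact_mod_cast this
  obtain ⟨t, ht⟩ : ∃ t : ℝ, t = n / ((a + b : ℤ) : ℝ) := ⟨_, rfl⟩
  have hn : t * a + t * b = n := by
    rw [ht, ← mul_add]; push_cast at hq ⊢; field_simp
  rw [← ht] at h1 h2
  obtain ⟨x, rfl⟩ := ha3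
  obtain ⟨y, rfl⟩ := hb3
  -- shift by `k / 3`
  obtain ⟨k, u, hk⟩ : ∃ k u : ℤ, c * k + ⌊3 * (t * c)⌋ = 1 + 3 * u := by
    generalize ⌊3 * (t * c)⌋ = i
    rcases (by omega : c % 3 = 1 ∨ c % 3 = 2) with h | h
    · refine ⟨1 - i, c / 3 * (1 - i), ?_⟩
      have := Int.emod_add_mul_ediv c 3
      rw [h] at this
      linear_combination (i - 1) * this
    · refine ⟨i - 1, c / 3 * (i - 1) + i - 1, ?_⟩
      have := Int.emod_add_mul_ediv c 3
      rw [h] at this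
      linear_combination (1 - i) * this
  have hk' : (c : ℝ) * k + ⌊3 * (t * c)⌋ = 1 + 3 * u := by exact_mod_cast hk
  have f1 := Int.floor_le (3 * (t * c))
  have f2 := (Int.lt_floor_add_one (3 * (t * c))).le
  push_cast at h1 h2 hn
  refine le_f3 (t + k / 3) (le_dnn (l + k * x) ?_ ?_) (le_dnn (n - l - 1 + k * y) ?_ ?_)
    (le_dnn u ?_ ?_)
  all_goals push_cast; linarith

lemma prim {a b c : ℤ} (ha : 0 < a) (hb : 0 < b) (hc : 0 < c)
    (hg : ∀ d : ℤ, d ∣ a → d ∣ b → d ∣ c → IsUnit d) : Concl a b c := by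
  by_cases ha3 : (3 : ℤ) ∣ a <;> by_cases hb3 : (3 : ℤ) ∣ b <;> by_cases hc3 : (3 : ℤ) ∣ c
  · have := hg 3 ha3 hb3 hc3
    rw [Int.isUnit_iff] at this
    omega
  · exact two_div ha hb ha3 hb3 hc3
  · exact (two_div ha hc ha3 hc3 hb3).swap23
  · exact (single_div' hb hc ha hb3 hc3 ha3 fun d h1 h2 h3 => hg d h3 h1 h2).swap23.swap12
  · exact (two_div hb hc hb3 hc3 ha3).swap23.swap12
  · exact (single_div' ha hc hb ha3 hc3 hb3 fun d h1 h2 h3 => hg d h1 h3 h2).swap23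
  · exact single_div' ha hb hc ha3 hb3 hc3 hg
  · right
    have key : ∀ x : ℤ, ¬ (3 : ℤ) ∣ x → (1 / 3 : ℝ) ≤ dnn (1 / 3 * x) := fun x hx => by
      have h1 : (3 * (x / 3) + 1 : ℤ) ≤ x := by omega
      have h2 : x ≤ (3 * (x / 3) + 2 : ℤ) := by omega
      have h1' : (3 * ((x / 3 : ℤ) : ℝ) + 1) ≤ x := by exact_mod_cast h1
      have h2' : (x : ℝ) ≤ 3 * ((x / 3 : ℤ) : ℝ) + 2 := by exact_mod_cast h2
      exact le_dnn (x / 3) (by linarith) (by linarith)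
    exact le_f3 (1 / 3) (key a ha3) (key b hb3) (key c hc3)


theorem stmt_13 (v₁ v₂ v₃ : ℕ) (h₁ : 0 < v₁) (h₂ : 0 < v₂) (h₃ : 0 < v₃) :
    (∃ s : ℕ, 0 < s ∧
        ML ![(v₁ : ℝ), (v₂ : ℝ), (v₃ : ℝ)] = (s : ℝ) / (3 * (s : ℝ) + 1)) ∨
      ML ![(v₁ : ℝ), (v₂ : ℝ), (v₃ : ℝ)] ≥ 1 / 3 := by
  rw [ML_eq]
  change Concl v₁ v₂ v₃
  obtain ⟨g, hg⟩ : ∃ g : ℕ, g = Nat.gcd (Nat.gcd v₁ v₂) v₃ := ⟨_, rfl⟩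
  have hg0 : 0 < g := by rw [hg]; exact Nat.gcd_pos_of_pos_right _ h₃
  obtain ⟨a, ha⟩ : g ∣ v₁ := hg ▸ (Nat.gcd_dvd_left _ _).trans (Nat.gcd_dvd_left _ _)
  obtain ⟨b, hb⟩ : g ∣ v₂ := hg ▸ (Nat.gcd_dvd_left _ _).trans (Nat.gcd_dvd_right _ _)
  obtain ⟨c, hc⟩ : g ∣ v₃ := hg ▸ Nat.gcd_dvd_right _ _
  have ha0 : 0 < a := Nat.pos_of_ne_zero (by rintro rfl; omega)
  have hb0 : 0 < b := Nat.pos_of_ne_zero (by rintro rfl; omega)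
  have hc0 : 0 < c := Nat.pos_of_ne_zero (by rintro rfl; omega)
  have h1 : Nat.gcd (Nat.gcd a b) c = 1 := by
    rw [ha, hb, hc, Nat.gcd_mul_left, Nat.gcd_mul_left] at hg
    exact Nat.eq_of_mul_eq_mul_left hg0 (by omega)
  have hp : Concl a b c := by
    refine prim (by exact_mod_cast ha0) (by exact_mod_cast hb0) (by exact_mod_cast hc0) ?_
    intro d d1 d2 d3
    rw [Int.isUnit_iff_natAbs_eq]
    have := Nat.dvd_gcd (Nat.dvd_gcd (Int.natCast_dvd_natCast.1 (Int.natAbs_dvd.2 d1))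
      (Int.natCast_dvd_natCast.1 (Int.natAbs_dvd.2 d2)))
      (Int.natCast_dvd_natCast.1 (Int.natAbs_dvd.2 d3))
    rw [h1] at this
    exact Nat.dvd_one.1 this
  unfold Concl at *
  rw [ha, hb, hc]
  push_cast
  rwa [f3_smul _ _ _ _ (by exact_mod_cast hg0.ne')]
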